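/- Let r > 1 and let k, ℓ, m be positive integers with m ≥ 12r. For every fixed initial mutant x_0 lying in one of the reservoirs R_1∪…∪R_ℓ, the discrete-time Moran process with fitness r on the (k,ℓ,m)-superstar started from the state {x_0} has extinction probability at least 1/(26·r²·ℓ). -/

import Mathlib

open Finset

/-- Total fitness of the mutant set `S` (mutants have fitness `r`, non-mutants fitness `1`). -/
noncomputable def moranW {V : Type*} [Fintype V] (r : ℝ) (S : Finset V) : ℝ :=
  r * S.card + ((Fintype.card V : ℝ) - S.card)

/-- One-step transition probability of the Moran process with fitness `r` and
reproduction weights `w`, from mutant set `S` to mutant set `T`:  a vertex `u` is chosen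
with probability `r / moranW r S` if it is a mutant and `1 / moranW r S` otherwise, then a
target `v` is chosen with probability `w u v`, and `v` becomes a mutant if `u` is one and
a non-mutant otherwise. -/
noncomputable def moranStep {V : Type*} [Fintype V] [DecidableEq V]
    (r : ℝ) (w : V → V → ℝ) (S T : Finset V) : ℝ :=
  ∑ u : V, ∑ v : V,
    ((if u ∈ S then r else 1) / moranW r S) * w u v *
      (if (if u ∈ S then insert v S else S.erase v) = T then 1 else 0)

/-- Distribution of the Moran process after `t` steps, from initial distribution `init`. -/
noncomputable def moranDist {V : Type*} [Fintype V] [DecidableEq V]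
    (r : ℝ) (w : V → V → ℝ) (init : Finset V → ℝ) : ℕ → Finset V → ℝ
  | 0 => init
  | t + 1 => fun T => ∑ S : Finset V, moranDist r w init t S * moranStep r w S T

/-- Reproduction weights of the (unweighted) Moran process on the digraph with
out-neighbourhoods `out`: the offspring goes to a uniformly random out-neighbour. -/
noncomputable def outWeights {V : Type*} [DecidableEq V]
    (out : V → Finset V) : V → V → ℝ :=
  fun u v => if v ∈ out u then ((out u).card : ℝ)⁻¹ else 0

/-- Extinction probability: `sup_t Pr(S_t = ∅)`. -/
noncomputable def extinctionProb {V : Type*} [Fintype V] [DecidableEq V]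
    (r : ℝ) (w : V → V → ℝ) (init : Finset V → ℝ) : ℝ :=
  ⨆ t : ℕ, moranDist r w init t (∅ : Finset V)

/-- Fixation probability: `sup_t Pr(S_t = V)`. -/
noncomputable def fixationProb {V : Type*} [Fintype V] [DecidableEq V]
    (r : ℝ) (w : V → V → ℝ) (init : Finset V → ℝ) : ℝ :=
  ⨆ t : ℕ, moranDist r w init t (Finset.univ : Finset V)

/-- Initial distribution: a single mutant at a uniformly random vertex. -/
noncomputable def uniformSingleton (V : Type*) [Fintype V] [DecidableEq V] :
    Finset V → ℝ :=
  fun S => if S.card = 1 then (Fintype.card V : ℝ)⁻¹ else 0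

/-- Initial distribution: a single mutant at the fixed vertex `x₀`. -/
def pointInit {V : Type*} [DecidableEq V] (x₀ : V) : Finset V → ℝ :=
  fun S => if S = {x₀} then 1 else 0

/-- Vertices of the `(k,ℓ,m)`-superstar: `ℓ` reservoirs `R_i` of size `m`
(`Sum.inl (i, x)`), path vertices `v_{i,j}` for `i ∈ [ℓ]`, `j ∈ [k]`
(`Sum.inr (Sum.inl (i, j))`), and the centre vertex `v*` (`Sum.inr (Sum.inr ())`).
It has `ℓ * (k + m) + 1` vertices. -/
abbrev SuperstarV (k ℓ m : ℕ) : Type :=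
  (Fin ℓ × Fin m) ⊕ ((Fin ℓ × Fin k) ⊕ Unit)

/-- Out-neighbourhoods of the `(k,ℓ,m)`-superstar: the centre points to every reservoir
vertex, each vertex of `R_i` points to `v_{i,1}`, each `v_{i,j}` points to `v_{i,j+1}`
for `j < k`, and `v_{i,k}` points to the centre. -/
def superstarOut (k ℓ m : ℕ) : SuperstarV k ℓ m → Finset (SuperstarV k ℓ m)
  | Sum.inl (i, _) =>
      if h : 0 < k then {Sum.inr (Sum.inl (i, ⟨0, h⟩))} else {Sum.inr (Sum.inr ())}
  | Sum.inr (Sum.inl (i, j)) =>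
      if h : (j : ℕ) + 1 < k then {Sum.inr (Sum.inl (i, ⟨(j : ℕ) + 1, h⟩))}
      else {Sum.inr (Sum.inr ())}
  | Sum.inr (Sum.inr _) =>
      (Finset.univ : Finset (Fin ℓ × Fin m)).image fun p => Sum.inl p


lemma moranW_eq {V : Type*} [Fintype V] [DecidableEq V] (r : ℝ) (S : Finset V) :
    moranW r S = ∑ u : V, (if u ∈ S then r else 1) := by
  have h : ∀ u : V, (if u ∈ S then r else (1:ℝ)) = (if u ∈ S then (r - 1) else 0) + 1 := by
    intro u; split_ifs <;> ring
  simp_rw [h, Finset.sum_add_distrib]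
  simp [moranW]
  ring

lemma moranW_pos {V : Type*} [Fintype V] [DecidableEq V] [Nonempty V] {r : ℝ} (hr : 1 < r)
    (S : Finset V) : 0 < moranW r S := by
  rw [moranW_eq]
  apply Finset.sum_pos
  · intro u _; split_ifs <;> linarith
  · exact Finset.univ_nonempty

lemma step_sum {V : Type*} [Fintype V] [DecidableEq V] (r : ℝ) (w : V → V → ℝ)
    (S : Finset V) (g : Finset V → ℝ) :
    ∑ T, moranStep r w S T * g T = ∑ u : V, ((if u ∈ S then r else 1) / moranW r S) *
      ∑ v : V, w u v * g (if u ∈ S then insert v S else S.erase v) := by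
  simp only [moranStep, Finset.sum_mul, Finset.mul_sum]
  rw [Finset.sum_comm]
  refine Finset.sum_congr rfl fun u _ => ?_
  rw [Finset.sum_comm]
  refine Finset.sum_congr rfl fun v _ => ?_
  rw [Finset.sum_eq_single (if u ∈ S then insert v S else S.erase v)]
  · simp; ring
  · intro b _ hb
    rw [if_neg (Ne.symm hb)]; ring
  · simp

lemma step_sum_sub {V : Type*} [Fintype V] [DecidableEq V] [Nonempty V] {r : ℝ} (hr : 1 < r)
    (w : V → V → ℝ) (hw : ∀ u, ∑ v, w u v = 1)
    (S : Finset V) (g : Finset V → ℝ) :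
    ∑ T, moranStep r w S T * g T = g S + (∑ u : V, (if u ∈ S then r else 1) *
      ∑ v : V, w u v * (g (if u ∈ S then insert v S else S.erase v) - g S)) / moranW r S := by
  have hW := moranW_pos hr S
  rw [step_sum]
  simp_rw [mul_sub, Finset.sum_sub_distrib, ← Finset.sum_mul, hw, one_mul, mul_sub,
    Finset.sum_sub_distrib, ← Finset.sum_mul]
  rw [← moranW_eq, sub_div, mul_div_cancel_left₀ _ hW.ne', Finset.sum_div]
  simp only [div_mul_eq_mul_div]
  ring

lemma moranStep_nonneg {V : Type*} [Fintype V] [DecidableEq V] [Nonempty V] {r : ℝ} (hr : 1 < r)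
    (w : V → V → ℝ) (hw0 : ∀ u v, 0 ≤ w u v) (S T : Finset V) : 0 ≤ moranStep r w S T := by
  have hW := moranW_pos hr S
  unfold moranStep
  refine Finset.sum_nonneg fun u _ => Finset.sum_nonneg fun v _ => ?_
  refine mul_nonneg (mul_nonneg (div_nonneg ?_ hW.le) (hw0 u v)) ?_ <;> split_ifs <;> linarith

lemma extinction_ge {V : Type*} [Fintype V] [DecidableEq V] [Nonempty V] {r : ℝ} (hr : 1 < r)
    (w : V → V → ℝ) (hw0 : ∀ u v, 0 ≤ w u v) (hw : ∀ u, ∑ v, w u v = 1) (x₀ : V)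
    (g : Finset V → ℝ) (hg0 : ∀ S, 0 ≤ g S) (hg1 : ∀ S, g S ≤ 1) (hge : g ∅ = 1)
    (δ : ℝ) (hδ : 0 < δ)
    (h : ∀ S, S ≠ ∅ → g S ≠ 0 → g S + δ ≤ ∑ T, moranStep r w S T * g T) :
    g {x₀} ≤ extinctionProb r w (pointInit x₀) := by
  have hs0 := moranStep_nonneg hr w hw0
  have hrow : ∀ S, ∑ T, moranStep r w S T = 1 := by
    intro S
    have := step_sum_sub hr w hw S (fun _ => 1)
    simpa using this
  set μ := moranDist r w (pointInit x₀) with hμ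
  have hμ0 : ∀ t S, 0 ≤ μ t S := by
    intro t
    induction t with
    | zero => intro S; simp only [hμ, moranDist, pointInit]; split_ifs <;> norm_num
    | succ t ih =>
      intro S
      exact Finset.sum_nonneg fun T _ => mul_nonneg (ih T) (hs0 T S)
  have hexp : ∀ (f : Finset V → ℝ) t, ∑ T, μ (t+1) T * f T
      = ∑ S, μ t S * ∑ T, moranStep r w S T * f T := by
    intro f t
    have : ∀ T, μ (t+1) T = ∑ S, μ t S * moranStep r w S T := fun T => rfl
    simp_rw [this, Finset.sum_mul, Finset.mul_sum]
    rw [Finset.sum_comm]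
    refine Finset.sum_congr rfl fun S _ => Finset.sum_congr rfl fun T _ => by ring
  have hmass : ∀ t, ∑ S, μ t S = 1 := by
    intro t
    induction t with
    | zero => simp [hμ, moranDist, pointInit]
    | succ t ih =>
      have := hexp (fun _ => 1) t
      simpa [hrow, ih] using this
  have hle1 : ∀ t S, μ t S ≤ 1 := by
    intro t S
    rw [← hmass t]
    exact Finset.single_le_sum (fun S _ => hμ0 t S) (Finset.mem_univ S)
  set E := extinctionProb r w (pointInit x₀) with hE
  have heE : ∀ t, μ t ∅ ≤ E := by
    intro t
    exact le_ciSup (f := fun t => μ t ∅) ⟨1, by rintro _ ⟨t, rfl⟩; exact hle1 t ∅⟩ t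
  have hempty : (1:ℝ) ≤ ∑ T, moranStep r w ∅ T * g T := by
    rw [step_sum_sub hr w hw]
    simp [hge]
  have hΦ : ∀ t, (∑ S, μ t S * g S) + δ * ((∑ S, μ t S * g S) - μ t ∅)
      ≤ ∑ S, μ (t+1) S * g S := by
    intro t
    rw [hexp]
    have e1 : μ t ∅ = ∑ S, μ t S * (if S = ∅ then 1 else 0) := by simp
    rw [e1, ← Finset.sum_sub_distrib, Finset.mul_sum, ← Finset.sum_add_distrib]
    refine Finset.sum_le_sum fun S _ => ?_
    have key : g S + δ * (g S - if S = ∅ then 1 else 0) ≤ ∑ T, moranStep r w S T * g T := by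
      by_cases hS : S = ∅
      · subst hS; simpa [hge] using hempty
      · by_cases hz : g S = 0
        · simp only [hS, hz, if_false, sub_zero, mul_zero, add_zero]
          exact Finset.sum_nonneg fun T _ => mul_nonneg (hs0 S T) (hg0 T)
        · have := h S hS hz
          have h1 := hg1 S
          simp only [hS, if_false, sub_zero]
          nlinarith
    have := mul_le_mul_of_nonneg_left key (hμ0 t S)
    linarith
  by_contra hcon
  push Not at hcon
  have hbase : ∑ S, μ 0 S * g S = g {x₀} := by
    simp [hμ, moranDist, pointInit]
  have hgrow : ∀ t : ℕ, (g {x₀} - E) * (1 + t * δ) ≤ (∑ S, μ t S * g S) - E := by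
    intro t
    induction t with
    | zero => simp [hbase]
    | succ t ih =>
      have h1 := hΦ t
      have h2 := heE t
      have h3 : (g {x₀} - E) ≤ (∑ S, μ t S * g S) - E := by
        have : 0 ≤ (g {x₀} - E) * (t * δ) := by
          have : 0 < g {x₀} - E := by linarith
          positivity
        linarith
      push_cast
      nlinarith
  have hup : ∀ t, ∑ S, μ t S * g S ≤ 1 := by
    intro t
    rw [← hmass t]
    exact Finset.sum_le_sum fun S _ => mul_le_of_le_one_right (hμ0 t S) (hg1 S)
  have hε : 0 < (g {x₀} - E) * δ := mul_pos (by linarith) hδ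
  obtain ⟨n, hn⟩ := exists_nat_gt ((1 - E) / ((g {x₀} - E) * δ))
  rw [div_lt_iff₀ hε] at hn
  have := hgrow n
  have := hup n
  nlinarith

lemma superstarOut_card_pos {k ℓ m : ℕ} (hℓ : 0 < ℓ) (hm0 : 0 < m) (u : SuperstarV k ℓ m) :
    (superstarOut k ℓ m u).Nonempty := by
  haveI : Nonempty (Fin ℓ × Fin m) := ⟨(⟨0, hℓ⟩, ⟨0, hm0⟩)⟩
  rcases u with ⟨i, x⟩ | ⟨i, j⟩ | _
  · simp only [superstarOut]; split_ifs <;> simp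
  · simp only [superstarOut]; split_ifs <;> simp
  · simp only [superstarOut]; simp

lemma outWeights_sum {V : Type*} [Fintype V] [DecidableEq V] (out : V → Finset V) (u : V)
    (h : (out u).Nonempty) (f : V → ℝ) :
    ∑ v, outWeights out u v * f v = ((out u).card : ℝ)⁻¹ * ∑ v ∈ out u, f v := by
  simp [outWeights, Finset.mul_sum, ite_mul, Finset.sum_ite_mem]

lemma ss_numeric (r ℓ m : ℝ) (hr : 1 < r) (hℓ : 1 ≤ ℓ) (hm : 12 * r ≤ m) :
    let a := 1 / (26 * r ^ 2 * ℓ)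
    let d := 1 / (4 * r * ℓ * m)
    0 < d ∧ d < a ∧ a ≤ 1 / 26 ∧
    0 < r * (-d) + (ℓ * m)⁻¹ * (1 - a) ∧
    0 < (m - 1) * d - r * (a - d) - (ℓ * m)⁻¹ * (a - d) := by
  intro a d
  have hl0 : 0 < ℓ := by linarith
  have hr0 : 0 < r := by linarith
  have hm0 : 0 < m := by linarith
  have hd : 0 < d := by positivity
  have ha : 0 < a := by positivity
  have hda : d < a := by
    apply one_div_lt_one_div_of_lt (by positivity)
    have : 26 * r < 4 * m := by linarith
    have h2 : 0 < r * ℓ := by positivity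
    nlinarith
  have ha26 : a ≤ 1 / 26 := by
    apply one_div_le_one_div_of_le (by norm_num)
    have : 1 ≤ r ^ 2 := by nlinarith
    nlinarith
  have hq : (ℓ * m)⁻¹ ≤ 1 := by
    apply inv_le_one_of_one_le₀; nlinarith
  have hq0 : 0 < (ℓ * m)⁻¹ := by positivity
  refine ⟨hd, hda, ha26, ?_, ?_⟩
  · have : r * d = (ℓ * m)⁻¹ / 4 := by simp only [d]; field_simp
    nlinarith
  · have e1 : m * d = (r * ℓ)⁻¹ / 4 := by simp only [d]; field_simp
    have e2 : r * a = (r * ℓ)⁻¹ / 26 := by simp only [a]; field_simp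
    have hp : 0 < (r * ℓ)⁻¹ := by positivity
    have h3 : 12 * d ≤ m * d := by nlinarith
    have h4 : (ℓ * m)⁻¹ * (a - d) ≤ 1 * (a - d) :=
      mul_le_mul_of_nonneg_right hq (by linarith)
    have h5 : a ≤ r * a := by nlinarith
    have h6 : 0 < r * d := by positivity
    nlinarith

/-- **Extinction lower bound for superstars from a reservoir** (Lemma 4.3).  Let `r > 1`
and let `k`, `ℓ`, `m` be positive integers with `m ≥ 12r`.  For every fixed initial
mutant `x₀` lying in a reservoir, the discrete-time Moran process with fitness `r` on
the `(k,ℓ,m)`-superstar started from `{x₀}` has extinction probability at least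
`1/(26·r²·ℓ)`. -/
theorem superstar_extinction_reservoir (r : ℝ) (hr : 1 < r) (k ℓ m : ℕ)
    (hk : 0 < k) (hℓ : 0 < ℓ) (hm0 : 0 < m) (hm : 12 * r ≤ (m : ℝ))
    (x₀ : SuperstarV k ℓ m) (hx₀ : ∃ i x, x₀ = Sum.inl (i, x)) :
    1 / (26 * r ^ 2 * (ℓ : ℝ)) ≤
      extinctionProb r (outWeights (superstarOut k ℓ m)) (pointInit x₀) := by
  obtain ⟨i, x, rfl⟩ := hx₀
  have hℓ1 : (1:ℝ) ≤ ℓ := by exact_mod_cast hℓ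
  have hnum := ss_numeric r ℓ m hr hℓ1 hm
  set a : ℝ := 1 / (26 * r ^ 2 * ℓ) with ha
  set d : ℝ := 1 / (4 * r * ℓ * m) with hd
  obtain ⟨hd0, hda, ha26, hA, hB⟩ := hnum
  set q : ℝ := ((ℓ:ℝ) * m)⁻¹ with hq
  set y : SuperstarV k ℓ m := Sum.inl (i, x) with hy
  set z : SuperstarV k ℓ m := Sum.inr (Sum.inl (i, ⟨0, hk⟩)) with hz
  have hyz : y ≠ z := by simp [hy, hz]
  have hout := superstarOut_card_pos (k := k) hℓ hm0
  set g : Finset (SuperstarV k ℓ m) → ℝ := fun S =>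
    if S = ∅ then 1 else if S = {y} then a else if S = {y, z} then a - d else 0 with hg
  have hpair : ({y, z} : Finset (SuperstarV k ℓ m)) ≠ {y} := by
    intro h
    have : z ∈ ({y} : Finset (SuperstarV k ℓ m)) := by rw [← h]; simp
    exact hyz (Finset.mem_singleton.mp this).symm
  have gE : g ∅ = 1 := by simp [hg]
  have gA : g {y} = a := by simp [hg]
  have gB : g {y, z} = a - d := by simp [hg, hpair]
  have g0 : ∀ S, 0 ≤ g S := by
    intro S; simp only [hg]; split_ifs <;> linarith
  have g1 : ∀ S, g S ≤ 1 := by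
    intro S; simp only [hg]; split_ifs <;> linarith
  haveI : Nonempty (SuperstarV k ℓ m) := ⟨y⟩
  have hw0 : ∀ u v, 0 ≤ outWeights (superstarOut k ℓ m) u v := by
    intro u v; unfold outWeights; split_ifs <;> positivity
  have hw : ∀ u, ∑ v, outWeights (superstarOut k ℓ m) u v = 1 := by
    intro u
    have := outWeights_sum (superstarOut k ℓ m) u (hout u) (fun _ => 1)
    simp only [mul_one, Finset.sum_const, nsmul_eq_mul] at this
    rw [this]
    exact inv_mul_cancel₀ (by exact_mod_cast (hout u).card_pos.ne')
  have sR : ∀ (i' : Fin ℓ) (x' : Fin m), superstarOut k ℓ m (Sum.inl (i', x'))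
      = {Sum.inr (Sum.inl (i', ⟨0, hk⟩))} := by
    intro i' x'; simp [superstarOut, hk]
  have sP : ∀ (i' : Fin ℓ) (j : Fin k), ∃ t, superstarOut k ℓ m (Sum.inr (Sum.inl (i', j))) = {t}
      ∧ t ≠ y ∧ t ≠ z := by
    intro i' j
    by_cases h : (j:ℕ) + 1 < k
    · exact ⟨Sum.inr (Sum.inl (i', ⟨(j:ℕ) + 1, h⟩)), by simp only [superstarOut, h, dif_pos], by simp [hy], by simp [hz]⟩
    · exact ⟨Sum.inr (Sum.inr ()), by simp only [superstarOut, h, dif_neg, not_false_iff], by simp [hy], by simp [hz]⟩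
  have sC : ∀ f : SuperstarV k ℓ m → ℝ, ((superstarOut k ℓ m (Sum.inr (Sum.inr ()))).card : ℝ)⁻¹ *
      ∑ v ∈ superstarOut k ℓ m (Sum.inr (Sum.inr ())), f v
      = q * ∑ p : Fin ℓ × Fin m, f (Sum.inl p) := by
    intro f
    have hinj : Function.Injective (fun p : Fin ℓ × Fin m => (Sum.inl p : SuperstarV k ℓ m)) :=
      Sum.inl_injective
    simp only [superstarOut]
    rw [Finset.sum_image (fun _ _ _ _ h => hinj h), Finset.card_image_of_injective _ hinj]
    simp [hq]
  have hstepA : (∑ u : SuperstarV k ℓ m, (if u ∈ ({y} : Finset (SuperstarV k ℓ m)) then r else 1) *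
      ∑ v, outWeights (superstarOut k ℓ m) u v *
        (g (if u ∈ ({y} : Finset (SuperstarV k ℓ m)) then insert v {y} else ({y} : Finset (SuperstarV k ℓ m)).erase v) - g {y}))
      = r * (-d) + q * (1 - a) := by
    simp_rw [fun u => outWeights_sum (superstarOut k ℓ m) u (hout u)]
    rw [Fintype.sum_sum_type, Fintype.sum_sum_type]
    have t1 : ∀ p : Fin ℓ × Fin m, p ≠ (i, x) →
        (Sum.inl p : SuperstarV k ℓ m) ∉ ({y} : Finset (SuperstarV k ℓ m)) := by
      intro p hp; simpa [hy] using hp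
    rw [Finset.sum_eq_single (i, x)]
    rotate_left
    · rintro ⟨i', x'⟩ _ hp
      rw [if_neg (t1 _ hp), sR]
      simp only [if_neg (t1 _ hp), Finset.sum_singleton]
      rw [Finset.erase_eq_of_notMem (by simp [hy])]
      simp
    · simp
    rw [Finset.sum_eq_zero (s := (univ : Finset (Fin ℓ × Fin k)))]
    rotate_left
    · rintro ⟨i', j⟩ _
      obtain ⟨t, ht, hty, htz⟩ := sP i' j
      have hn : (Sum.inr (Sum.inl (i', j)) : SuperstarV k ℓ m) ∉ ({y} : Finset (SuperstarV k ℓ m)) := by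
        simp [hy]
      simp only [if_neg hn, ht, Finset.sum_singleton]
      rw [Finset.erase_eq_of_notMem (by simpa using hty)]
      simp
    have hn : (Sum.inr (Sum.inr ()) : SuperstarV k ℓ m) ∉ ({y} : Finset (SuperstarV k ℓ m)) := by
      simp [hy]
    rw [Fintype.sum_unique]
    change _ + (0 + (if (Sum.inr (Sum.inr ()) : SuperstarV k ℓ m) ∈ ({y} : Finset (SuperstarV k ℓ m)) then r else 1) *
      (((superstarOut k ℓ m (Sum.inr (Sum.inr ()))).card : ℝ)⁻¹ *
      ∑ v ∈ superstarOut k ℓ m (Sum.inr (Sum.inr ())), (g (if (Sum.inr (Sum.inr ()) : SuperstarV k ℓ m) ∈ ({y} : Finset (SuperstarV k ℓ m)) then insert v {y} else ({y} : Finset (SuperstarV k ℓ m)).erase v) - g {y}))) = _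
    rw [sC]
    simp only [if_neg hn]
    rw [Finset.sum_eq_single (i, x)]
    rotate_left
    · intro p _ hp
      rw [Finset.erase_eq_of_notMem]
      · simp
      · intro hmem
        exact t1 p hp (by simpa using hmem)
    · simp
    rw [sR, if_pos (Finset.mem_singleton_self y), ← hz, ← hy]
    simp only [Finset.sum_singleton, Finset.mem_singleton_self, if_true, Finset.card_singleton]
    rw [Finset.pair_comm, gB, gA, Finset.erase_singleton, gE]
    norm_num
  have hstepB : (m - 1) * d - r * (a - d) - q * (a - d) ≤
      (∑ u : SuperstarV k ℓ m, (if u ∈ ({y, z} : Finset (SuperstarV k ℓ m)) then r else 1) *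
      ∑ v, outWeights (superstarOut k ℓ m) u v *
        (g (if u ∈ ({y, z} : Finset (SuperstarV k ℓ m)) then insert v {y, z} else ({y, z} : Finset (SuperstarV k ℓ m)).erase v) - g {y, z})) := by
    simp_rw [fun u => outWeights_sum (superstarOut k ℓ m) u (hout u)]
    rw [Fintype.sum_sum_type, Fintype.sum_sum_type]
    have t1 : ∀ p : Fin ℓ × Fin m, p ≠ (i, x) →
        (Sum.inl p : SuperstarV k ℓ m) ∉ ({y, z} : Finset (SuperstarV k ℓ m)) := by
      intro p hp; simpa [hy, hz] using hp
    have eBz : ({y, z} : Finset (SuperstarV k ℓ m)).erase z = {y} := by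
      rw [Finset.pair_comm, Finset.erase_insert (by simpa using hyz.symm)]
    have p1 : ((m:ℝ) - 1) * d = ∑ p : Fin ℓ × Fin m, if p.1 = i ∧ p.2 ≠ x then d else 0 := by
      rw [Fintype.sum_prod_type, Finset.sum_eq_single i]
      · have : ∀ x' : Fin m, (if i = i ∧ x' ≠ x then d else 0) = d - if x' = x then d else 0 := by
          intro x'; by_cases h : x' = x <;> simp [h]
        rw [Finset.sum_congr rfl (fun x' _ => this x'), Finset.sum_sub_distrib]
        simp; ring
      · intro b _ hb; simp [hb]
      · simp
    have p2 : -(r * (a - d)) = ∑ p : Fin ℓ × Fin k, if p = (i, ⟨0, hk⟩) then -(r * (a-d)) else 0 := by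
      simp
    have p3 : -(a - d) = ∑ p : Fin ℓ × Fin m, if p = (i, x) then -(a-d) else 0 := by
      simp
    have : (m - 1) * d - r * (a - d) - q * (a - d)
      = (m - 1) * d + (-(r * (a - d)) + q * (-(a - d))) := by ring
    rw [this]
    refine add_le_add ?_ (add_le_add ?_ ?_)
    · rw [p1]
      refine Finset.sum_le_sum ?_
      rintro ⟨i', x'⟩ _
      rw [sR]
      simp only [Finset.sum_singleton, Finset.card_singleton, Nat.cast_one, inv_one, one_mul]
      by_cases hp : (i', x') = (i, x)
      · obtain ⟨rfl, rfl⟩ := Prod.mk.inj hp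
        have hmem : (Sum.inl (i', x') : SuperstarV k ℓ m) ∈ ({y, z} : Finset (SuperstarV k ℓ m)) := by
          simp [hy]
        simp only [if_pos hmem, ← hz]
        rw [Finset.insert_eq_of_mem (by simp)]
        simp
      · simp only [if_neg (t1 _ hp), one_mul]
        by_cases hi : i' = i
        · subst hi
          rw [← hz, eBz, gA, gB]
          split_ifs <;> linarith
        · rw [Finset.erase_eq_of_notMem (by simp [hy, hz, hi])]
          simp [hi]
    · rw [p2]
      refine Finset.sum_le_sum ?_
      rintro ⟨i', j⟩ _
      obtain ⟨t, ht, hty, htz⟩ := sP i' j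
      rw [ht]
      simp only [Finset.sum_singleton, Finset.card_singleton, Nat.cast_one, inv_one, one_mul]
      by_cases hp : (i', j) = (i, ⟨0, hk⟩)
      · obtain ⟨rfl, rfl⟩ := Prod.mk.inj hp
        have hmem : (Sum.inr (Sum.inl (i', ⟨0, hk⟩)) : SuperstarV k ℓ m) ∈ ({y, z} : Finset (SuperstarV k ℓ m)) := by
          simp [hz]
        simp only [if_pos hmem, if_true, gB]
        have := g0 (insert t {y, z})
        nlinarith
      · have hn : (Sum.inr (Sum.inl (i', j)) : SuperstarV k ℓ m) ∉ ({y, z} : Finset (SuperstarV k ℓ m)) := by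
          simpa [hy, hz] using hp
        simp only [if_neg hn, if_neg hp]
        rw [Finset.erase_eq_of_notMem (by simp [hty, htz])]
        simp
    · have hn : (Sum.inr (Sum.inr ()) : SuperstarV k ℓ m) ∉ ({y, z} : Finset (SuperstarV k ℓ m)) := by
        simp [hy, hz]
      rw [Fintype.sum_unique]
      change _ ≤ (if (Sum.inr (Sum.inr ()) : SuperstarV k ℓ m) ∈ ({y, z} : Finset (SuperstarV k ℓ m)) then r else 1) *
        (((superstarOut k ℓ m (Sum.inr (Sum.inr ()))).card : ℝ)⁻¹ *
        ∑ v ∈ superstarOut k ℓ m (Sum.inr (Sum.inr ())), (g (if (Sum.inr (Sum.inr ()) : SuperstarV k ℓ m) ∈ ({y, z} : Finset (SuperstarV k ℓ m)) then insert v {y, z} else ({y, z} : Finset (SuperstarV k ℓ m)).erase v) - g {y, z}))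
      rw [sC]
      simp only [if_neg hn, one_mul]
      refine mul_le_mul_of_nonneg_left ?_ (by positivity)
      rw [p3]
      refine Finset.sum_le_sum fun p _ => ?_
      by_cases hp : p = (i, x)
      · rw [if_pos hp, gB]
        have := g0 (({y, z} : Finset (SuperstarV k ℓ m)).erase (Sum.inl p))
        linarith
      · rw [if_neg hp, Finset.erase_eq_of_notMem (t1 p hp)]
        simp
  have hWA := moranW_pos hr ({y} : Finset (SuperstarV k ℓ m))
  have hWB := moranW_pos hr ({y, z} : Finset (SuperstarV k ℓ m))
  have hfin := extinction_ge hr (outWeights (superstarOut k ℓ m)) hw0 hw y g g0 g1 gE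
    (min ((r * (-d) + q * (1 - a)) / moranW r {y})
      (((m - 1) * d - r * (a - d) - q * (a - d)) / moranW r {y, z}))
    (lt_min (div_pos hA hWA) (div_pos hB hWB)) ?_
  · rwa [gA] at hfin
  · intro S hS hgS
    rw [step_sum_sub hr _ hw]
    by_cases h1 : S = {y}
    · subst h1
      rw [hstepA]
      exact add_le_add le_rfl (min_le_left _ _)
    · by_cases h2 : S = {y, z}
      · subst h2
        exact add_le_add le_rfl ((min_le_right _ _).trans (div_le_div_of_nonneg_right hstepB hWB.le))
      · exact absurd (by simp [hg, hS, h1, h2]) hgS
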